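/- Let w, Δw, x ∈ ℝ with w + Δw ≠ 0, and let f ∈ ℝ (the fractional part of x). Define error(Δx) = (w + Δw)·Δx + Δw·x and B(x) = Δw·x/(w + Δw) + 1/2. If f < B(x), then error(-f)² < error(1 - f)². -/

import Mathlib

theorem stmt_1 (w dw x f : ℝ) (h : w + dw ≠ 0)
    (error : ℝ → ℝ) (herr : ∀ dx, error dx = (w + dw) * dx + dw * x)
    (B : ℝ) (hB : B = dw * x / (w + dw) + 1 / 2)
    (hf : f < B) :
    error (-f) ^ 2 < error (1 - f) ^ 2 := by
  have key : error (1 - f) ^ 2 - error (-f) ^ 2 = 2 * (w + dw) ^ 2 * (B - f) := by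
    rw [herr, herr, hB]
    field_simp
    ring
  have pos : 0 < 2 * (w + dw) ^ 2 * (B - f) :=
    mul_pos (by positivity) (sub_pos.mpr hf)
  linarith
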